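/- Let n ≥ 1, let b : Fin n → Fin n → ℝ be a symmetric function with b i j > 0 for all i ≠ j, and let a : Fin n → ℝ satisfy a i ≥ 0 for all i and a i₀ > 0 for some i₀. Let G and H be connected simple graphs on Fin n with G ≠ H. Then the matrices diag(a) + L(G,b) and diag(a) + L(H,b) are both invertible and their inverses are distinct: (diag(a) + L(G,b))⁻¹ ≠ (diag(a) + L(H,b))⁻¹. -/

import Mathlib

open Classical Matrix

/-- The weighted Laplacian of a simple graph `G` on `Fin n` with weight function `b`. -/
noncomputable def weightedLaplacian {n : ℕ} (G : SimpleGraph (Fin n))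
    (b : Fin n → Fin n → ℝ) : Matrix (Fin n) (Fin n) ℝ :=
  Matrix.of fun i j =>
    if i = j then ∑ k, (if G.Adj i k then b i k else 0)
    else if G.Adj i j then -b i j else 0

theorem weightedLaplacian_mulVec_apply {n : ℕ} (G : SimpleGraph (Fin n))
    (b : Fin n → Fin n → ℝ) (v : Fin n → ℝ) (i : Fin n) :
    (weightedLaplacian G b *ᵥ v) i = ∑ k, if G.Adj i k then b i k * (v i - v k) else 0 := by
  have hentry : ∀ j, weightedLaplacian G b i j =
      (if i = j then ∑ k, (if G.Adj i k then b i k else 0) else 0) -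
        (if G.Adj i j then b i j else 0) := by
    intro j
    by_cases hij : i = j
    · subst hij
      simp [weightedLaplacian]
    · by_cases hadj : G.Adj i j <;> simp [weightedLaplacian, hij, hadj]
  simp only [Matrix.mulVec, dotProduct, hentry, sub_mul, Finset.sum_sub_distrib, ite_mul, zero_mul,
    Finset.sum_ite_eq, Finset.mem_univ, if_true, Finset.sum_mul]
  rw [← Finset.sum_sub_distrib]
  refine Finset.sum_congr rfl fun k _ => ?_
  split_ifs <;> ring

/-- Maximum principle for a grounded weighted Laplacian. -/
theorem nonpos_of_diagonal_add_weightedLaplacian_mulVec_eq_zero {n : ℕ}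
    {b : Fin n → Fin n → ℝ} (hpos : ∀ i j, i ≠ j → 0 < b i j)
    {a : Fin n → ℝ} (ha : ∀ i, 0 ≤ a i) (ha' : ∃ i₀, 0 < a i₀)
    {G : SimpleGraph (Fin n)} (hG : G.Connected) {v : Fin n → ℝ}
    (hv : (Matrix.diagonal a + weightedLaplacian G b) *ᵥ v = 0) (i : Fin n) : v i ≤ 0 := by
  have : Nonempty (Fin n) := ⟨i⟩
  obtain ⟨m, hm⟩ := Finite.exists_max v
  by_contra! hi
  have hvm : 0 < v m := hi.trans_le (hm i)
  have hmax : ∀ x, v x = v m → a x = 0 ∧ ∀ y, G.Adj x y → v y = v m := by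
    intro x hx
    have hrow := congrFun hv x
    rw [Matrix.add_mulVec, Pi.add_apply, Matrix.mulVec_diagonal,
      weightedLaplacian_mulVec_apply, Pi.zero_apply] at hrow
    have hterm : ∀ k ∈ Finset.univ,
        0 ≤ if G.Adj x k then b x k * (v x - v k) else 0 := by
      intro k _
      split_ifs with hadj
      · exact mul_nonneg (hpos x k hadj.ne).le (by linarith [hm k])
      · exact le_rfl
    have hax : 0 ≤ a x * v x := mul_nonneg (ha x) (hx ▸ hvm.le)
    obtain ⟨hax_zero, hsum⟩ := (add_eq_zero_iff_of_nonneg hax (Finset.sum_nonneg hterm)).1 hrow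
    refine ⟨(mul_eq_zero.1 hax_zero).resolve_right (hx ▸ hvm.ne'), fun y hadj => ?_⟩
    have hy := (Finset.sum_eq_zero_iff_of_nonneg hterm).1 hsum y (Finset.mem_univ y)
    rw [if_pos hadj] at hy
    have := (mul_eq_zero.1 hy).resolve_left (hpos x y hadj.ne).ne'
    linarith
  have hwalk : ∀ x y, G.Walk x y → v x = v m → v y = v m := by
    intro x y p
    induction p with
    | nil => exact id
    | cons hadj _ ih => exact fun hx => ih ((hmax _ hx).2 _ hadj)
  obtain ⟨i₀, hi₀⟩ := ha'
  obtain ⟨p⟩ := hG.preconnected m i₀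
  exact hi₀.ne' (hmax i₀ (hwalk m i₀ p rfl)).1

theorem isUnit_diagonal_add_weightedLaplacian {n : ℕ}
    {b : Fin n → Fin n → ℝ} (hpos : ∀ i j, i ≠ j → 0 < b i j)
    {a : Fin n → ℝ} (ha : ∀ i, 0 ≤ a i) (ha' : ∃ i₀, 0 < a i₀)
    {G : SimpleGraph (Fin n)} (hG : G.Connected) :
    IsUnit (Matrix.diagonal a + weightedLaplacian G b) := by
  rw [Matrix.isUnit_iff_isUnit_det, isUnit_iff_ne_zero]
  intro hdet
  obtain ⟨v, hv, hzero⟩ := Matrix.exists_mulVec_eq_zero_iff.2 hdet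
  have hneg : (Matrix.diagonal a + weightedLaplacian G b) *ᵥ (-v) = 0 := by
    rw [Matrix.mulVec_neg, hzero, neg_zero]
  refine hv (funext fun i => le_antisymm ?_ ?_)
  · exact nonpos_of_diagonal_add_weightedLaplacian_mulVec_eq_zero hpos ha ha' hG hzero i
  · exact neg_nonpos.1
      (nonpos_of_diagonal_add_weightedLaplacian_mulVec_eq_zero hpos ha ha' hG hneg i)

theorem weightedLaplacian_injective {n : ℕ} {b : Fin n → Fin n → ℝ}
    (hb : ∀ i j, i ≠ j → b i j ≠ 0) :
    Function.Injective fun G : SimpleGraph (Fin n) => weightedLaplacian G b := by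
  intro G H h
  ext i j
  by_cases hij : i = j
  · simp [hij]
  · have hentry := congrFun (congrFun h i) j
    by_cases hG : G.Adj i j <;> by_cases hH : H.Adj i j <;>
      simp [weightedLaplacian, hij, hG, hH, hb i j hij] at hentry ⊢

theorem inverses_distinct_of_graphs_distinct
    (n : ℕ) (hn : 1 ≤ n)
    (b : Fin n → Fin n → ℝ) (hsymm : ∀ i j, b i j = b j i)
    (hpos : ∀ i j, i ≠ j → 0 < b i j)
    (a : Fin n → ℝ) (ha : ∀ i, 0 ≤ a i) (ha' : ∃ i₀, 0 < a i₀)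
    (G H : SimpleGraph (Fin n)) (hGconn : G.Connected) (hHconn : H.Connected)
    (hGH : G ≠ H) :
    IsUnit (Matrix.diagonal a + weightedLaplacian G b) ∧
    IsUnit (Matrix.diagonal a + weightedLaplacian H b) ∧
    (Matrix.diagonal a + weightedLaplacian G b)⁻¹ ≠
      (Matrix.diagonal a + weightedLaplacian H b)⁻¹ := by
  have hG := isUnit_diagonal_add_weightedLaplacian hpos ha ha' hGconn
  have hH := isUnit_diagonal_add_weightedLaplacian hpos ha ha' hHconn
  refine ⟨hG, hH, fun h => hGH ?_⟩
  have hinv := congrArg (·⁻¹) h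
  simp only [Matrix.nonsing_inv_nonsing_inv _ ((Matrix.isUnit_iff_isUnit_det _).1 hG),
    Matrix.nonsing_inv_nonsing_inv _ ((Matrix.isUnit_iff_isUnit_det _).1 hH)] at hinv
  exact weightedLaplacian_injective (fun i j hij => (hpos i j hij).ne') (add_left_cancel hinv)
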